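/- arXiv:1704.07773 — 2 statements merged into one kernel-verified Lean document; each statement's English description precedes it below -/
import Mathlib

section
/- Consider the deterministic MPC setting with horizon N ≥ 1. Suppose Assumption 1 holds (for every x ∈ X there exists u ∈ U with c(x,u) + c_N(f(x,u)) ≤ c_N(x)), and let μ : X → U be an MPC policy for horizon N, i.e. c(x,μ(x)) + J_{N-1}^⋆(f(x,μ(x))) = J_N^⋆(x) for all x. Then the closed-loop stage cost is dominated by the decrease of the optimal value function: for every x ∈ X, c(x,μ(x)) ≤ J_N^⋆(x) − J_N^⋆(f(x,μ(x))). -/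
open scoped ENNReal

noncomputable section

variable {X U : Type*}

/-- Open-loop trajectory: `x_{k+1} = f(x_k, u_k)`. -/
def traj (f : X → U → X) (x0 : X) (u : ℕ → U) : ℕ → X
  | 0 => x0
  | k + 1 => f (traj f x0 u k) (u k)

/-- `N`-horizon cost `J_N(x0, u) = Σ_{k=0}^{N-1} c(x_k,u_k) + c_N(x_N)`. -/
def costN (f : X → U → X) (c : X → U → NNReal) (cT : X → NNReal)
    (N : ℕ) (x0 : X) (u : ℕ → U) : ℝ≥0∞ :=
  (∑ k ∈ Finset.range N, (c (traj f x0 u k) (u k) : ℝ≥0∞)) +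
    (cT (traj f x0 u N) : ℝ≥0∞)

/-- Finite-horizon optimal value function `J_N^⋆(x) = inf_u J_N(x,u)`. -/
def valN (f : X → U → X) (c : X → U → NNReal) (cT : X → NNReal)
    (N : ℕ) (x : X) : ℝ≥0∞ :=
  ⨅ u : ℕ → U, costN f c cT N x u

/-- Infinite-horizon cost `J_∞(x0, u) = Σ_{k=0}^∞ c(x_k,u_k) ∈ [0,∞]`. -/
def costInf (f : X → U → X) (c : X → U → NNReal) (x0 : X) (u : ℕ → U) : ℝ≥0∞ :=
  ∑' k, (c (traj f x0 u k) (u k) : ℝ≥0∞)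

/-- Infinite-horizon optimal value function `J_∞^⋆(x) = inf_u J_∞(x,u)`. -/
def valInf (f : X → U → X) (c : X → U → NNReal) (x : X) : ℝ≥0∞ :=
  ⨅ u : ℕ → U, costInf f c x u

/-- Closed-loop trajectory under repeated application of policy `μ`. -/
def clTraj (f : X → U → X) (μ : X → U) (x0 : X) : ℕ → X
  | 0 => x0
  | k + 1 => f (clTraj f μ x0 k) (μ (clTraj f μ x0 k))

/-- Achieved infinite-horizon MPC cost `J_∞(x0, μ_MPC)`. -/
def clCost (f : X → U → X) (c : X → U → NNReal) (μ : X → U) (x0 : X) : ℝ≥0∞ :=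
  ∑' k, (c (clTraj f μ x0 k) (μ (clTraj f μ x0 k)) : ℝ≥0∞)

theorem traj_congr_aux (f : X → U → X) (x0 : X) (u v : ℕ → U) (n : ℕ)
    (h : ∀ k, k < n → u k = v k) : traj f x0 u n = traj f x0 v n := by
  induction n with
  | zero => rfl
  | succ k ih =>
    simp only [traj]
    rw [ih (fun j hj => h j (by omega)), h k (by omega)]

theorem valN_succ_le_aux (f : X → U → X) (c : X → U → NNReal) (cT : X → NNReal)
    (hassm : ∀ x : X, ∃ u : U, c x u + cT (f x u) ≤ cT x) (n : ℕ) (x : X) :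
    valN f c cT (n + 1) x ≤ valN f c cT n x := by
  unfold valN
  refine le_iInf fun u => ?_
  obtain ⟨w, hw⟩ := hassm (traj f x u n)
  let v : ℕ → U := fun k => if k < n then u k else w
  have hv : ∀ k, k < n → v k = u k := fun k hk => by simp [v, hk]
  have hvn : v n = w := by simp [v]
  have ht : ∀ k, k ≤ n → traj f x v k = traj f x u k := fun k hk =>
    traj_congr_aux f x v u k (fun j hj => hv j (by omega))
  refine (iInf_le _ v).trans ?_
  unfold costN
  rw [Finset.sum_range_succ, add_assoc]
  refine add_le_add (le_of_eq (Finset.sum_congr rfl fun k hk => ?_)) ?_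
  · have hk' := Finset.mem_range.1 hk
    rw [ht k hk'.le, hv k hk']
  · simp only [traj]
    rw [ht n le_rfl, hvn]
    exact_mod_cast hw

/-- For an MPC policy `μ` of horizon `N ≥ 1`, under the terminal-cost contraction
assumption, the closed-loop stage cost is dominated by the decrease of the optimal
value function: `c(x,μ(x)) ≤ J_N^⋆(x) − J_N^⋆(f(x,μ(x)))`. -/
theorem stmt_3 [Nonempty X] [Nonempty U]
    (f : X → U → X) (c : X → U → NNReal) (cT : X → NNReal)
    (N : ℕ) (hN : 1 ≤ N)
    (hassm : ∀ x : X, ∃ u : U, c x u + cT (f x u) ≤ cT x)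
    (μ : X → U)
    (hμ : ∀ x : X,
      (c x (μ x) : ℝ≥0∞) + valN f c cT (N - 1) (f x (μ x)) = valN f c cT N x)
    (x : X) :
    (c x (μ x) : ℝ≥0∞) ≤ valN f c cT N x - valN f c cT N (f x (μ x)) := by
  obtain ⟨n, rfl⟩ : ∃ n, N = n + 1 := ⟨N - 1, by omega⟩
  have hfin : valN f c cT (n + 1) (f x (μ x)) ≠ ⊤ := by
    refine ne_top_of_le_ne_top ?_ (iInf_le _ (fun _ => Classical.arbitrary U))
    unfold costN
    exact ENNReal.add_ne_top.2
      ⟨ENNReal.sum_ne_top.2 (fun _ _ => ENNReal.coe_ne_top), ENNReal.coe_ne_top⟩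
  refine ENNReal.le_sub_of_add_le_right hfin ?_
  rw [← hμ x]
  exact add_le_add le_rfl (valN_succ_le_aux f c cT hassm n _)
end
end

section
/- Theorem (performance of SMPC for POMDPs). In the POMDP control setting with horizon N ≥ 1 and discount α ∈ (0,1), suppose Assumption 3 holds: there exist η ≥ 0 and a policy g̃ : Δ(S) → A such that for every belief π ∈ Δ(S), α Σ_{i,j} π_i P(g̃(π))_{ij} cT_j ≤ Σ_i π_i (cT_i − c(g̃(π))_i) + η/α^{N−1}. Let μ : Δ(S) → A be an MPC policy for horizon N. Then for every belief π ∈ Δ(S): J_∞^⋆(π) ≤ J_∞(π,μ_MPC) ≤ J_N^⋆(π) + (α/(1−α)) η, where J_∞(π,μ_MPC) is the infinite-horizon discounted closed-loop cost of the stationary policy μ and J_∞^⋆(π) is the infimum of J_∞(π,g) over all stationary belief policies g. -/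
open scoped ENNReal

noncomputable section

variable {S A O : Type*}

/-- Observation likelihood `σ(π,a,θ) = Σ_{i,j} π_i P(a)_{ij} R(a)_{jθ}`. -/
def lik [Fintype S] (P : A → S → S → ℝ) (R : A → S → O → ℝ)
    (π : S → ℝ) (a : A) (θ : O) : ℝ :=
  ∑ i, ∑ j, π i * P a i j * R a j θ

/-- Bayesian belief update `T(π,a,θ)`; by convention `T(π,a,θ) = π` when `σ(π,a,θ) = 0`. -/
def upd [Fintype S] (P : A → S → S → ℝ) (R : A → S → O → ℝ)
    (π : S → ℝ) (a : A) (θ : O) : S → ℝ :=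
  if 0 < lik P R π a θ then
    fun j => (∑ i, π i * P a i j * R a j θ) / lik P R π a θ
  else π

/-- Finite-horizon optimal value functions by dynamic programming:
`J_0^⋆(π) = π cT`, `J_{k+1}^⋆(π) = min_a [π c(a) + α Σ_θ σ(π,a,θ) J_k^⋆(T(π,a,θ))]`. -/
def Jstar [Fintype S] [Fintype O] (P : A → S → S → ℝ) (R : A → S → O → ℝ)
    (c : A → S → ℝ) (cT : S → ℝ) (α : ℝ) : ℕ → (S → ℝ) → ℝ
  | 0, π => ∑ j, π j * cT j
  | k + 1, π => ⨅ a : A, (∑ i, π i * c a i +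
      α * ∑ θ, lik P R π a θ * Jstar P R c cT α k (upd P R π a θ))

/-- `M`-step closed-loop cost of the stationary belief policy `g`. -/
def Vcl [Fintype S] [Fintype O] (P : A → S → S → ℝ) (R : A → S → O → ℝ)
    (c : A → S → ℝ) (α : ℝ) (g : (S → ℝ) → A) : ℕ → (S → ℝ) → ℝ
  | 0, _ => 0
  | M + 1, π => ∑ i, π i * c (g π) i +
      α * ∑ θ, lik P R π (g π) θ * Vcl P R c α g M (upd P R π (g π) θ)

/-- Infinite-horizon discounted closed-loop cost `J_∞(π,g) = sup_M V_M^g(π) ∈ [0,∞]`. -/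
def Jinf [Fintype S] [Fintype O] (P : A → S → S → ℝ) (R : A → S → O → ℝ)
    (c : A → S → ℝ) (α : ℝ) (g : (S → ℝ) → A) (π : S → ℝ) : ℝ≥0∞ :=
  ⨆ M, ENNReal.ofReal (Vcl P R c α g M π)

/-- Optimal infinite-horizon value `J_∞^⋆(π) = inf_g J_∞(π,g)` over stationary policies. -/
def JinfStar [Fintype S] [Fintype O] (P : A → S → S → ℝ) (R : A → S → O → ℝ)
    (c : A → S → ℝ) (α : ℝ) (π : S → ℝ) : ℝ≥0∞ :=
  ⨅ g : (S → ℝ) → A, Jinf P R c α g π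

section helpers

variable [Fintype S] (P : A → S → S → ℝ) (R : A → S → O → ℝ)

theorem aux_lik_nonneg (hP : ∀ a i, (∀ j, 0 ≤ P a i j) ∧ ∑ j, P a i j = 1)
    {θ : O} (hR : ∀ a j, 0 ≤ R a j θ) {π : S → ℝ} (hπ : π ∈ stdSimplex ℝ S) (a : A) :
    0 ≤ lik P R π a θ :=
  Finset.sum_nonneg fun i _ => Finset.sum_nonneg fun j _ =>
    mul_nonneg (mul_nonneg (hπ.1 i) ((hP a i).1 j)) (hR a j)

theorem aux_lik_sum [Fintype O] (hP : ∀ a i, (∀ j, 0 ≤ P a i j) ∧ ∑ j, P a i j = 1)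
    (hR : ∀ a j, (∀ θ, 0 ≤ R a j θ) ∧ ∑ θ, R a j θ = 1)
    {π : S → ℝ} (hπ : π ∈ stdSimplex ℝ S) (a : A) :
    ∑ θ, lik P R π a θ = 1 := by
  unfold lik
  rw [Finset.sum_comm]
  have h : ∀ i, ∑ θ, ∑ j, π i * P a i j * R a j θ = π i := by
    intro i
    rw [Finset.sum_comm]
    simp only [← Finset.mul_sum, (hR a _).2, mul_one, (hP a i).2]
  simp only [h]
  exact hπ.2

theorem aux_lik_upd (hP : ∀ a i, (∀ j, 0 ≤ P a i j) ∧ ∑ j, P a i j = 1)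
    {θ : O} (hR : ∀ a j, 0 ≤ R a j θ)
    {π : S → ℝ} (hπ : π ∈ stdSimplex ℝ S) (a : A) (j : S) :
    lik P R π a θ * upd P R π a θ j = ∑ i, π i * P a i j * R a j θ := by
  have hn : ∀ i j, 0 ≤ π i * P a i j * R a j θ := fun i j =>
    mul_nonneg (mul_nonneg (hπ.1 i) ((hP a i).1 j)) (hR a j)
  unfold upd
  split_ifs with h
  · exact mul_div_cancel₀ _ h.ne'
  · have h0 : lik P R π a θ = 0 :=
      le_antisymm (not_lt.1 h) (aux_lik_nonneg P R hP hR hπ a)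
    rw [h0, zero_mul]
    unfold lik at h0
    rw [Finset.sum_comm, Finset.sum_eq_zero_iff_of_nonneg
      (fun j _ => Finset.sum_nonneg fun i _ => hn i j)] at h0
    exact (h0 j (Finset.mem_univ _)).symm

theorem aux_upd_mem (hP : ∀ a i, (∀ j, 0 ≤ P a i j) ∧ ∑ j, P a i j = 1)
    {θ : O} (hR : ∀ a j, 0 ≤ R a j θ)
    {π : S → ℝ} (hπ : π ∈ stdSimplex ℝ S) (a : A) :
    upd P R π a θ ∈ stdSimplex ℝ S := by
  unfold upd
  split_ifs with h
  · refine ⟨fun j => div_nonneg (Finset.sum_nonneg fun i _ =>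
      mul_nonneg (mul_nonneg (hπ.1 i) ((hP a i).1 j)) (hR a j)) h.le, ?_⟩
    rw [← Finset.sum_div, Finset.sum_comm]
    exact div_self h.ne'
  · exact hπ

theorem aux_exp_cT [Fintype O] (hP : ∀ a i, (∀ j, 0 ≤ P a i j) ∧ ∑ j, P a i j = 1)
    (hR : ∀ a j, (∀ θ, 0 ≤ R a j θ) ∧ ∑ θ, R a j θ = 1) (cT : S → ℝ)
    {π : S → ℝ} (hπ : π ∈ stdSimplex ℝ S) (a : A) :
    ∑ θ, lik P R π a θ * ∑ j, upd P R π a θ j * cT j =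
      ∑ i, ∑ j, π i * P a i j * cT j := by
  have h : ∀ θ, lik P R π a θ * ∑ j, upd P R π a θ j * cT j =
      ∑ j, (∑ i, π i * P a i j) * cT j * R a j θ := by
    intro θ
    rw [Finset.mul_sum]
    refine Finset.sum_congr rfl fun j _ => ?_
    rw [← mul_assoc, aux_lik_upd P R hP (fun a j => (hR a j).1 θ) hπ, ← Finset.sum_mul]
    ring
  simp only [h]
  rw [Finset.sum_comm]
  simp only [← Finset.mul_sum, (hR a _).2, mul_one]
  simp only [Finset.sum_mul]
  exact Finset.sum_comm

end helpers

/-- Theorem 3 (performance of SMPC for POMDPs): under Assumption 3 (expected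
terminal-cost contraction with slack `η/α^{N−1}` under some policy `g̃`), the MPC
policy `μ` of horizon `N ≥ 1` satisfies
`J_∞^⋆(π) ≤ J_∞(π,μ_MPC) ≤ J_N^⋆(π) + (α/(1−α)) η`. -/
theorem stmt_10 [Fintype S] [Fintype A] [Fintype O]
    [Nonempty S] [Nonempty A] [Nonempty O]
    (P : A → S → S → ℝ) (R : A → S → O → ℝ)
    (hP : ∀ a i, (∀ j, 0 ≤ P a i j) ∧ ∑ j, P a i j = 1)
    (hR : ∀ a j, (∀ θ, 0 ≤ R a j θ) ∧ ∑ θ, R a j θ = 1)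
    (c : A → S → ℝ) (hc : ∀ a i, 0 ≤ c a i)
    (cT : S → ℝ) (hcT : ∀ i, 0 ≤ cT i)
    (α : ℝ) (hα0 : 0 < α) (hα1 : α < 1)
    (N : ℕ) (hN : 1 ≤ N)
    (η : ℝ) (hη : 0 ≤ η) (gt : (S → ℝ) → A)
    (hassm : ∀ π ∈ stdSimplex ℝ S,
      α * ∑ i, ∑ j, π i * P (gt π) i j * cT j ≤
        (∑ i, π i * (cT i - c (gt π) i)) + η / α ^ (N - 1))
    (μ : (S → ℝ) → A)
    (hμ : ∀ π ∈ stdSimplex ℝ S,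
      Jstar P R c cT α N π = ∑ i, π i * c (μ π) i +
        α * ∑ θ, lik P R π (μ π) θ * Jstar P R c cT α (N - 1) (upd P R π (μ π) θ))
    (π : S → ℝ) (hπ : π ∈ stdSimplex ℝ S) :
    JinfStar P R c α π ≤ Jinf P R c α μ π ∧
      Jinf P R c α μ π ≤
        ENNReal.ofReal (Jstar P R c cT α N π + α / (1 - α) * η) := by
  refine ⟨iInf_le _ μ, ?_⟩
  have hL : ∀ π ∈ stdSimplex ℝ S, ∀ a θ, 0 ≤ lik P R π a θ := fun π hπ a θ =>
    aux_lik_nonneg P R hP (fun a j => (hR a j).1 θ) hπ a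
  have hU : ∀ π ∈ stdSimplex ℝ S, ∀ a θ, upd P R π a θ ∈ stdSimplex ℝ S := fun π hπ a θ =>
    aux_upd_mem P R hP (fun a j => (hR a j).1 θ) hπ a
  -- expectation of a pointwise bound with constant slack
  have hE : ∀ (f g : (S → ℝ) → ℝ) (d : ℝ), (∀ π ∈ stdSimplex ℝ S, f π ≤ g π + d) →
      ∀ π ∈ stdSimplex ℝ S, ∀ a, ∑ θ, lik P R π a θ * f (upd P R π a θ) ≤
        ∑ θ, lik P R π a θ * g (upd P R π a θ) + d := by
    intro f g d h π hπ a
    calc ∑ θ, lik P R π a θ * f (upd P R π a θ)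
        ≤ ∑ θ, lik P R π a θ * (g (upd P R π a θ) + d) :=
          Finset.sum_le_sum fun θ _ =>
            mul_le_mul_of_nonneg_left (h _ (hU π hπ a θ)) (hL π hπ a θ)
      _ = _ := by
          simp only [mul_add, Finset.sum_add_distrib]
          rw [← Finset.sum_mul, aux_lik_sum P R hP hR hπ a, one_mul]
  have hJle : ∀ k π a, Jstar P R c cT α (k + 1) π ≤ ∑ i, π i * c a i +
      α * ∑ θ, lik P R π a θ * Jstar P R c cT α k (upd P R π a θ) := by
    intro k π a
    rw [Jstar]
    exact ciInf_le (Set.finite_range _).bddBelow a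
  have hJ0 : ∀ k, ∀ π ∈ stdSimplex ℝ S, 0 ≤ Jstar P R c cT α k π := by
    intro k
    induction k with
    | zero =>
      intro π hπ
      rw [Jstar]
      exact Finset.sum_nonneg fun i _ => mul_nonneg (hπ.1 i) (hcT i)
    | succ k ih =>
      intro π hπ
      rw [Jstar]
      refine le_ciInf fun a => add_nonneg
        (Finset.sum_nonneg fun i _ => mul_nonneg (hπ.1 i) (hc a i))
        (mul_nonneg hα0.le (Finset.sum_nonneg fun θ _ =>
          mul_nonneg (hL π hπ a θ) (ih _ (hU π hπ a θ))))
  have hJs : ∀ k, ∀ π ∈ stdSimplex ℝ S, Jstar P R c cT α (k + 1) π ≤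
      Jstar P R c cT α k π + α ^ k * (η / α ^ (N - 1)) := by
    intro k
    induction k with
    | zero =>
      intro π hπ
      have h1 := hJle 0 π (gt π)
      have h2 := hassm π hπ
      have h3 := aux_exp_cT P R hP hR cT hπ (gt π)
      simp only [Jstar.eq_1] at h1 ⊢
      rw [h3] at h1
      simp only [mul_sub, Finset.sum_sub_distrib] at h2
      rw [pow_zero, one_mul]
      linarith
    | succ k ih =>
      intro π hπ
      rw [Jstar.eq_2 (k := k), ← sub_le_iff_le_add]
      refine le_ciInf fun a => ?_
      have h1 := hJle (k + 1) π a
      have h2 := mul_le_mul_of_nonneg_left (hE _ _ _ ih π hπ a) hα0.le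
      rw [pow_succ]
      linarith
  obtain ⟨n, rfl⟩ : ∃ n, N = n + 1 := ⟨N - 1, by omega⟩
  simp only [Nat.add_sub_cancel] at *
  have hn : ∀ π ∈ stdSimplex ℝ S, Jstar P R c cT α (n + 1) π ≤ Jstar P R c cT α n π + η := by
    intro π hπ
    have h := hJs n π hπ
    rwa [mul_div_cancel₀ _ (pow_pos hα0 n).ne'] at h
  have h1α : 0 < 1 - α := by linarith
  have hV : ∀ M, ∀ π ∈ stdSimplex ℝ S, Vcl P R c α μ M π ≤
      Jstar P R c cT α (n + 1) π + α / (1 - α) * η := by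
    intro M
    induction M with
    | zero =>
      intro π hπ
      rw [Vcl]
      exact add_nonneg (hJ0 _ π hπ) (by positivity)
    | succ M ih =>
      intro π hπ
      rw [Vcl, hμ π hπ]
      have h1 : ∀ π ∈ stdSimplex ℝ S, Vcl P R c α μ M π ≤
          Jstar P R c cT α n π + (η + α / (1 - α) * η) := fun π hπ => by
        linarith [ih π hπ, hn π hπ]
      have h2 := mul_le_mul_of_nonneg_left (hE _ _ _ h1 π hπ (μ π)) hα0.le
      have h3 : α * (η + α / (1 - α) * η) = α / (1 - α) * η := by
        field_simp
        ring
      linarith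
  exact iSup_le fun M => ENNReal.ofReal_le_ofReal (hV M π hπ)
end
end
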